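/- Let Ω ⊆ ℝⁿ be an open set and let u ≥ v be convex functions on Ω. Suppose there exists a constant C ≥ 1 with Mu(E) ≤ C·Mv(E) for every Borel set E ⊆ Ω, and that both Mu and Mv satisfy the doubling condition on Ω. Let Ω₀ = {x ∈ Ω : u(x) = v(x)} be the coincidence set. Then Σ_u ∩ Ω₀ = Σ_v ∩ Ω₀. -/

import Mathlib

open MeasureTheory Set
open scoped RealInnerProductSpace ENNReal

noncomputable section

abbrev En (n : ℕ) := EuclideanSpace ℝ (Fin n)

/-- The subgradient of `u` (as a convex function on `Ω`) at `x`. -/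
def subgrad {n : ℕ} (Ω : Set (En n)) (u : En n → ℝ) (x : En n) : Set (En n) :=
  {p | ∀ y ∈ Ω, u x + ⟪p, y - x⟫ ≤ u y}

/-- The Monge–Ampère measure of `u` on a set `s`. -/
def MAm {n : ℕ} (Ω : Set (En n)) (u : En n → ℝ) (s : Set (En n)) : ℝ≥0∞ :=
  volume (⋃ x ∈ s, subgrad Ω u x)

/-- `x₀` is a strictly convex point of `u` on `Ω`. -/
def IsStrictConvexPt {n : ℕ} (Ω : Set (En n)) (u : En n → ℝ) (x₀ : En n) : Prop :=
  ∀ x ∈ Ω, x ≠ x₀ → u ((1/2 : ℝ) • (x + x₀)) < (u x + u x₀) / 2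

/-- `Σ_u`: the set of non-strictly convex points of `u` in `Ω`. -/
def SigmaSet {n : ℕ} (Ω : Set (En n)) (u : En n → ℝ) : Set (En n) :=
  {x ∈ Ω | ¬ IsStrictConvexPt Ω u x}

/-- The centroid (center of mass with respect to Lebesgue measure) of a set. -/
def centroid {n : ℕ} (s : Set (En n)) : En n :=
  (volume s).toReal⁻¹ • ∫ x in s, x

/-- A set function `ν` satisfies the doubling condition on `U`. -/
def Doubling {n : ℕ} (ν : Set (En n) → ℝ≥0∞) (U : Set (En n)) : Prop :=
  ∃ c b : ℝ, c ∈ Set.Ioo (0 : ℝ) 1 ∧ 0 < b ∧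
    ∀ s : Set (En n), s ⊆ U → Convex ℝ s → Bornology.IsBounded s → (interior s).Nonempty →
      ENNReal.ofReal b * ν s ≤ ν ((fun y => centroid s + c • (y - centroid s)) '' s)


/-- A convex function on an open set has a subgradient at each point. -/
theorem exists_mem_subgrad {n : ℕ} {Ω : Set (En n)} (hΩ : IsOpen Ω) {u : En n → ℝ}
    (hu : ConvexOn ℝ Ω u) {x : En n} (hx : x ∈ Ω) : ∃ p, p ∈ subgrad Ω u x := by
  have hcont : ContinuousOn u Ω := hu.continuousOn hΩ
  have hopen : IsOpen {q : En n × ℝ | q.1 ∈ Ω ∧ u q.1 < q.2} := by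
    have h1 : IsOpen (Ω ×ˢ (univ : Set ℝ)) := hΩ.prod isOpen_univ
    have h2 : ContinuousOn (fun q : En n × ℝ => u q.1 - q.2) (Ω ×ˢ univ) :=
      (hcont.comp continuousOn_fst (fun q hq => hq.1)).sub continuousOn_snd
    convert h2.isOpen_inter_preimage h1 (isOpen_Iio (a := (0 : ℝ))) using 1
    ext q; simp
  obtain ⟨F, hF⟩ := geometric_hahn_banach_open_point hu.convex_strict_epigraph hopen
    (x := (x, u x)) (by simp)
  set α := F (0, 1) with hα
  have hsplit : ∀ y t, F (y, t) = F (y, 0) + t * α := by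
    intro y t
    rw [hα, ← smul_eq_mul, ← map_smul, ← map_add]; simp
  have hneg : α < 0 := by
    have := hF (x, u x + 1) ⟨hx, by simp⟩
    rw [hsplit, hsplit x (u x)] at this
    linarith
  let f : StrongDual ℝ (En n) := (-α)⁻¹ • (F.comp (ContinuousLinearMap.inl ℝ (En n) ℝ))
  refine ⟨(InnerProductSpace.toDual ℝ (En n)).symm f, fun y hy => ?_⟩
  rw [InnerProductSpace.toDual_symm_apply]
  have key : F (y, 0) - F (x, 0) ≤ -α * (u y - u x) := by
    refine le_of_forall_pos_lt_add fun ε hε => ?_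
    have := hF (y, u y + ε / (-α)) ⟨hy, by
      have : 0 < ε / (-α) := div_pos hε (by linarith)
      simpa using this⟩
    rw [hsplit, hsplit x (u x)] at this
    have h3 : ε / (-α) * α = -ε := by
      have := hneg.ne
      field_simp
    nlinarith
  have h4 : f (y - x) = (-α)⁻¹ * (F (y, 0) - F (x, 0)) := by
    simp only [f, smul_apply, ContinuousLinearMap.comp_apply,
      ContinuousLinearMap.inl_apply, smul_eq_mul, ← map_sub]
    simp
  rw [h4, inv_mul_eq_div]
  have : (F (y, 0) - F (x, 0)) / (-α) ≤ u y - u x := by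
    rw [div_le_iff₀ (by linarith)]; linarith
  linarith

theorem MAm_mono {n : ℕ} {Ω : Set (En n)} {u : En n → ℝ} {s t : Set (En n)} (h : s ⊆ t) :
    MAm Ω u s ≤ MAm Ω u t :=
  measure_mono (biUnion_mono h fun _ _ => subset_rfl)

/-- The Monge–Ampère measure is unchanged when an affine function is subtracted. -/
theorem MAm_sub_affine {n : ℕ} (Ω : Set (En n)) (u : En n → ℝ) (a : En n) (b : ℝ) :
    MAm Ω (fun y => u y - (⟪a, y⟫ + b)) = MAm Ω u := by
  funext s
  have h : ∀ x, subgrad Ω (fun y => u y - (⟪a, y⟫ + b)) x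
      = (fun p => p + a) ⁻¹' subgrad Ω u x := by
    intro x
    ext p
    simp only [subgrad, mem_ofPred_eq, mem_preimage, inner_add_left, inner_sub_right]
    refine forall₂_congr fun y _ => ⟨fun h => by linarith, fun h => by linarith⟩
  simp only [MAm, h, ← preimage_iUnion]
  exact measure_preimage_add_right volume a _

theorem ConvexOn.sub_affine {n : ℕ} {Ω : Set (En n)} {u : En n → ℝ} (hu : ConvexOn ℝ Ω u)
    (a : En n) (b : ℝ) : ConvexOn ℝ Ω (fun y => u y - (⟪a, y⟫ + b)) := by
  refine ⟨hu.1, fun x hx y hy s t hs ht hst => ?_⟩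
  have := hu.2 hx hy hs ht hst
  simp only [smul_eq_mul, inner_add_right, inner_smul_right] at this ⊢
  have hb : b = s * b + t * b := by rw [← add_mul, hst, one_mul]
  linarith

/-- Polar body of `s` with respect to the point `z`. -/
def polarAt {n : ℕ} (s : Set (En n)) (z : En n) : Set (En n) :=
  {q | ∀ y ∈ s, ⟪q, y - z⟫ ≤ 1}

theorem isClosed_polarAt {n : ℕ} (s : Set (En n)) (z : En n) : IsClosed (polarAt s z) := by
  simp only [polarAt, ofPred_forall]
  exact isClosed_iInter fun y => isClosed_iInter fun _ =>
    isClosed_le (by fun_prop) continuous_const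

theorem convex_polarAt {n : ℕ} (s : Set (En n)) (z : En n) : Convex ℝ (polarAt s z) := by
  intro p hp q hq a b ha hb hab y hy
  have h1 := hp y hy
  have h2 := hq y hy
  rw [inner_add_left, real_inner_smul_left, real_inner_smul_left]
  nlinarith

theorem centroid_mem_closure {n : ℕ} {s : Set (En n)} (ho : IsOpen s) (hc : Convex ℝ s)
    (hb : Bornology.IsBounded s) (hne : s.Nonempty) : centroid s ∈ closure s := by
  have h0 : volume s ≠ 0 := (ho.measure_pos volume hne).ne'
  have ht : volume s ≠ ∞ := hb.measure_lt_top.ne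
  have hint : IntegrableOn (fun x : En n => x) s :=
    (continuous_id.continuousOn.integrableOn_compact
      (Metric.isCompact_of_isClosed_isBounded isClosed_closure hb.closure)).mono_set subset_closure
  have := hc.set_average_mem_closure h0 ht (ae_restrict_mem ho.measurableSet) hint
  rw [setAverage_eq] at this
  exact this

/-- The reflection of a polar body about the centroid is comparable with the polar body. -/
theorem abs_inner_centroid_le {n : ℕ} {s : Set (En n)} (ho : IsOpen s) (hc : Convex ℝ s)
    (hb : Bornology.IsBounded s) {q : En n} (hq : q ∈ polarAt s (centroid s)) {y : En n}
    (hy : y ∈ s) : |⟪q, y - centroid s⟫| ≤ 2 ^ (n + 1) := by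
  have h0 : 0 < volume s := ho.measure_pos volume ⟨y, hy⟩
  have ht : volume s ≠ ∞ := hb.measure_lt_top.ne
  have hV : 0 < (volume s).toReal := ENNReal.toReal_pos h0.ne' ht
  have hcpt : IsCompact (closure s) :=
    Metric.isCompact_of_isClosed_isBounded isClosed_closure hb.closure
  have hint : IntegrableOn (fun x : En n => x) s :=
    (continuous_id.continuousOn.integrableOn_compact hcpt).mono_set subset_closure
  set z := centroid s with hz
  set ψ : En n → ℝ := fun x => 1 - ⟪q, x - z⟫ with hψ
  have hψint : IntegrableOn ψ s :=
    (ContinuousOn.integrableOn_compact hcpt (by fun_prop)).mono_set subset_closure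
  have hψnn : ∀ x ∈ s, 0 ≤ ψ x := fun x hx => by have := hq x hx; simp only [hψ]; linarith
  have htotal : ∫ x in s, ψ x = (volume s).toReal := by
    have h1 : ∫ x in s, ⟪q, x⟫ = (volume s).toReal * ⟪q, z⟫ := by
      rw [integral_inner hint q, hz, centroid, inner_smul_right, ← mul_assoc,
        mul_inv_cancel₀ hV.ne', one_mul]
    have h2 : ∀ x, ψ x = (1 + ⟪q, z⟫) - ⟪q, x⟫ := fun x => by
      simp only [hψ, inner_sub_right]; ring
    simp only [h2]
    have hi : IntegrableOn (fun x : En n => ⟪q, x⟫) s :=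
      (ContinuousOn.integrableOn_compact hcpt (by fun_prop)).mono_set subset_closure
    have hk : IntegrableOn (fun _ : En n => 1 + ⟪q, z⟫) s := integrableOn_const ht
    rw [integral_sub hk hi, h1, setIntegral_const]
    simp only [smul_eq_mul, Measure.real]
    ring
  set s' := AffineMap.homothety y (1 / 2 : ℝ) '' s with hs'
  have hpt : ∀ x, AffineMap.homothety y (1 / 2 : ℝ) x = (1 / 2 : ℝ) • x + (1 / 2 : ℝ) • y := by
    intro x
    rw [AffineMap.homothety_apply, vsub_eq_sub, vadd_eq_add, smul_sub]
    module
  have hs's : s' ⊆ s := by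
    rintro _ ⟨x, hx, rfl⟩
    rw [hpt]
    exact hc hx hy (by norm_num) (by norm_num) (by norm_num)
  have hvol : volume s' = ENNReal.ofReal ((1 / 2) ^ n) * volume s := by
    rw [hs', Measure.addHaar_image_homothety, abs_of_pos (by positivity)]
    simp
  have hmeas : MeasurableSet s' := by
    have : IsOpen s' := (AffineMap.homothety_isOpenMap y (1 / 2 : ℝ) (by norm_num)) s ho
    exact this.measurableSet
  have hlow : ∀ x ∈ s', ψ y / 2 ≤ ψ x := by
    rintro _ ⟨x, hx, rfl⟩
    have h1 := hψnn x hx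
    rw [hpt]
    simp only [hψ, inner_sub_right, inner_add_right, inner_smul_right] at h1 ⊢
    linarith
  have h3 : ∫ x in s', ψ x ≤ ∫ x in s, ψ x :=
    setIntegral_mono_set hψint ((ae_restrict_mem ho.measurableSet).mono hψnn)
      (Filter.Eventually.of_forall hs's)
  have h4 : (volume s').toReal * (ψ y / 2) ≤ ∫ x in s', ψ x := by
    have : ∫ _ in s', ψ y / 2 = (volume s').toReal * (ψ y / 2) := by
      rw [setIntegral_const]; simp [Measure.real]
    rw [← this]
    exact setIntegral_mono_on
      (integrableOn_const (measure_ne_top_of_subset hs's ht)) (hψint.mono_set hs's) hmeas hlow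
  rw [htotal] at h3
  rw [hvol, ENNReal.toReal_mul, ENNReal.toReal_ofReal (by positivity)] at h4
  have h5 : (1 / 2 : ℝ) ^ n * (ψ y / 2) ≤ 1 := by
    by_contra hcon
    push Not at hcon
    nlinarith
  have h6 : ψ y ≤ 2 ^ (n + 1) := by
    have h7 : (2 : ℝ) ^ (n + 1) * ((1 / 2 : ℝ) ^ n * (ψ y / 2)) = ψ y := by
      rw [pow_succ, one_div, inv_pow]; field_simp
    calc ψ y = (2 : ℝ) ^ (n + 1) * ((1 / 2 : ℝ) ^ n * (ψ y / 2)) := h7.symm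
      _ ≤ (2 : ℝ) ^ (n + 1) * 1 := by gcongr
      _ = _ := mul_one _
  have h8 := hq y hy
  have h9 : (1 : ℝ) ≤ 2 ^ (n + 1) := one_le_pow₀ (by norm_num)
  rw [abs_le]
  constructor
  · simp only [hψ] at h6; linarith
  · linarith

theorem closedBall_subset_polarAt {n : ℕ} {s : Set (En n)} {z : En n} {r : ℝ} (hr : 0 < r)
    (h : ∀ y ∈ s, ‖y - z‖ ≤ r) : Metric.closedBall 0 r⁻¹ ⊆ polarAt s z := by
  intro q hq y hy
  rw [mem_closedBall_zero_iff] at hq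
  calc ⟪q, y - z⟫ ≤ ‖q‖ * ‖y - z‖ := real_inner_le_norm _ _
    _ ≤ r⁻¹ * r := by gcongr; exact h y hy
    _ = 1 := inv_mul_cancel₀ hr.ne'

theorem volume_polarAt_pos {n : ℕ} {s : Set (En n)} (hb : Bornology.IsBounded s) (z : En n) :
    0 < volume (polarAt s z) := by
  obtain ⟨r, hr, hs⟩ := hb.subset_closedBall_lt 0 z
  have hsub := closedBall_subset_polarAt hr (s := s) (z := z)
    (fun y hy => by simpa [dist_eq_norm] using hs hy)
  exact (Metric.measure_closedBall_pos volume (0 : En n) (inv_pos.2 hr)).trans_le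
    (measure_mono hsub)

theorem volume_polarAt_lt_top {n : ℕ} {s : Set (En n)} (ho : IsOpen s) (hc : Convex ℝ s)
    (hb : Bornology.IsBounded s) (hne : s.Nonempty) :
    volume (polarAt s (centroid s)) < ∞ := by
  obtain ⟨y, hy⟩ := hne
  obtain ⟨r, hr, hs⟩ := Metric.isOpen_iff.1 ho y hy
  set K : ℝ := 2 ^ (n + 1)
  have : polarAt s (centroid s) ⊆ Metric.closedBall 0 (4 * K / r) := by
    intro q hq
    rw [mem_closedBall_zero_iff]
    rcases eq_or_ne q 0 with rfl | hq0
    · simp; positivity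
    have hn : 0 < ‖q‖ := norm_pos_iff.2 hq0
    have hy' : y + (r / 2 / ‖q‖) • q ∈ s := by
      apply hs
      rw [Metric.mem_ball, dist_eq_norm, add_sub_cancel_left, norm_smul, Real.norm_of_nonneg
        (by positivity), div_mul_cancel₀ _ hn.ne']
      linarith
    have h1 := (abs_le.1 (abs_inner_centroid_le ho hc hb hq hy')).2
    have h2 := (abs_le.1 (abs_inner_centroid_le ho hc hb hq hy)).1
    have h3 : ⟪q, y + (r / 2 / ‖q‖) • q - centroid s⟫
        = ⟪q, y - centroid s⟫ + r / 2 * ‖q‖ := by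
      rw [add_sub_right_comm, inner_add_right, inner_smul_right, real_inner_self_eq_norm_sq]
      field_simp
    rw [le_div_iff₀ hr]
    rw [h3] at h1
    linarith
  exact (measure_mono this).trans_lt Metric.isBounded_closedBall.measure_lt_top

/-- Packing: if `N` translates of a slab-like set lie in `P`, spaced further than the width of
the slab, then `P` has at least `N` times its volume. -/
theorem nat_mul_volume_le {n : ℕ} {D P : Set (En n)} (hD : MeasurableSet D) {d e : En n} {s : ℝ}
    (hd : ∀ q ∈ D, |⟪d, q⟫| ≤ s) (he : 2 * s < ⟪d, e⟫) (N : ℕ)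
    (hP : ∀ i < N, ∀ q ∈ D, q + (i : ℝ) • e ∈ P) : N * volume D ≤ volume P := by
  have hdisj : Pairwise (Function.onFun Disjoint
      fun i : Fin N => (fun q => q + (-((i : ℕ) : ℝ)) • e) ⁻¹' D) := by
    have main : ∀ i j : Fin N, i < j → ∀ q, q + (-((i : ℕ) : ℝ)) • e ∈ D →
        q + (-((j : ℕ) : ℝ)) • e ∈ D → False := by
      intro i j hij q h1 h2
      have h1' := (abs_le.1 (hd _ h1)).2
      have h2' := (abs_le.1 (hd _ h2)).1
      have hs : 0 ≤ s := (abs_nonneg _).trans (hd _ h1)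
      rw [inner_add_right, inner_smul_right] at h1' h2'
      have hij' : ((i : ℕ) : ℝ) + 1 ≤ ((j : ℕ) : ℝ) := by exact_mod_cast hij
      nlinarith
    intro i j hij
    rw [Function.onFun, Set.disjoint_left]
    intro q h1 h2
    rcases lt_or_gt_of_ne hij with h | h
    · exact main i j h q h1 h2
    · exact main j i h q h2 h1
  have hsub : (⋃ i : Fin N, (fun q => q + (-((i : ℕ) : ℝ)) • e) ⁻¹' D) ⊆ P := by
    refine iUnion_subset fun i q hq => ?_
    have := hP i i.2 _ hq
    simpa [add_assoc, ← add_smul] using this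
  calc N * volume D = ∑ i : Fin N, volume ((fun q => q + (-((i : ℕ) : ℝ)) • e) ⁻¹' D) := by
        simp only [measure_preimage_add_right]; simp
    _ = volume (⋃ i : Fin N, (fun q => q + (-((i : ℕ) : ℝ)) • e) ⁻¹' D) := by
        rw [measure_iUnion hdisj fun i => (measurable_id.add_const _) hD, tsum_fintype]
    _ ≤ volume P := measure_mono hsub

theorem smul_centroid_image_subset {n : ℕ} {s : Set (En n)} (ho : IsOpen s) (hc : Convex ℝ s)
    (hb : Bornology.IsBounded s) {c : ℝ} (hc0 : 0 < c) (hc1 : c < 1) :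
    (fun y => centroid s + c • (y - centroid s)) '' s ⊆ s := by
  rintro _ ⟨y, hy, rfl⟩
  have h := hc.combo_interior_closure_mem_interior (ho.interior_eq.symm ▸ hy)
    (centroid_mem_closure ho hc hb ⟨y, hy⟩) hc0 (by linarith : 0 ≤ 1 - c) (by ring)
  rw [ho.interior_eq] at h
  convert h using 1
  module

theorem measurableSet_centroid_image {n : ℕ} {s : Set (En n)} (ho : IsOpen s) {c : ℝ}
    (hc0 : 0 < c) : MeasurableSet ((fun y => centroid s + c • (y - centroid s)) '' s) := by
  have : IsOpen (AffineMap.homothety (centroid s) c '' s) :=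
    AffineMap.homothety_isOpenMap (centroid s) c hc0.ne' s ho
  convert this.measurableSet using 1
  refine image_congr fun y _ => ?_
  rw [AffineMap.homothety_apply, vsub_eq_sub, vadd_eq_add, add_comm]

theorem isOpen_section {n : ℕ} {Ω : Set (En n)} (hΩ : IsOpen Ω) {g : En n → ℝ}
    (hg : ConvexOn ℝ Ω g) : IsOpen {x ∈ Ω | g x < 0} :=
  (hg.continuousOn hΩ).isOpen_inter_preimage hΩ (isOpen_Iio (a := (0 : ℝ)))

/-- If `p` has small oscillation relative to the depth of `g` at `z`, then `p` is a subgradient of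
`g` at some point of the section `{g < 0}`. -/
theorem subset_iUnion_subgrad {n : ℕ} {Ω : Set (En n)} (hΩ : IsOpen Ω) {g : En n → ℝ}
    (hg : ConvexOn ℝ Ω g) (hcl : closure {x ∈ Ω | g x < 0} ⊆ Ω)
    (hb : Bornology.IsBounded {x ∈ Ω | g x < 0}) {z : En n} {h : ℝ} (hh : 0 < h)
    (hz : z ∈ Ω) (hgz : g z ≤ -h) :
    {p : En n | ∀ y ∈ {x ∈ Ω | g x < 0}, ⟪p, y - z⟫ ≤ h / 2} ⊆
      ⋃ x ∈ {x ∈ Ω | g x < 0}, subgrad Ω g x := by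
  intro p hp
  set S := {x ∈ Ω | g x < 0} with hS
  have hzS : z ∈ S := ⟨hz, by linarith⟩
  have hcpt : IsCompact (closure S) :=
    Metric.isCompact_of_isClosed_isBounded isClosed_closure hb.closure
  set G : En n → ℝ := fun y => g y - (⟪p, y⟫ + 0) with hG
  have hGconv : ConvexOn ℝ Ω G := hg.sub_affine p 0
  have hGcont : ContinuousOn G Ω := hGconv.continuousOn hΩ
  obtain ⟨x, hx, hmin⟩ := hcpt.exists_isMinOn ⟨z, subset_closure hzS⟩ (hGcont.mono hcl)
  have hpx : ⟪p, x - z⟫ ≤ h / 2 := by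
    have hc : IsClosed {y : En n | ⟪p, y - z⟫ ≤ h / 2} :=
      isClosed_le (by fun_prop) continuous_const
    exact closure_minimal (fun y hy => hp y hy) hc hx
  have hGx : G x ≤ G z := hmin (subset_closure hzS)
  have hxS : x ∈ S := by
    refine ⟨hcl hx, ?_⟩
    simp only [hG] at hGx
    rw [inner_sub_right] at hpx
    linarith
  have hSo : IsOpen S := isOpen_section hΩ hg
  have hloc : IsLocalMinOn G Ω x := by
    have : S ∈ nhds x := hSo.mem_nhds hxS
    exact Filter.mem_of_superset (mem_nhdsWithin_of_mem_nhds this)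
      fun y hy => hmin (subset_closure hy)
  have hglob := IsMinOn.of_isLocalMinOn_of_convexOn hxS.1 hloc hGconv
  refine mem_iUnion₂.2 ⟨x, hxS, fun y hy => ?_⟩
  have := hglob hy
  simp only [hG, mem_ofPred_eq] at this
  rw [inner_sub_right]
  linarith

/-- Subgradients over a contracted copy of `s` lie in a dilate of the polar body of `s`. -/
theorem inner_le_of_mem_subgrad {n : ℕ} {Ω s : Set (En n)} {w : En n → ℝ} {c H : ℝ}
    {x y q : En n} (hx : -H ≤ w (centroid s + c • (x - centroid s)))
    (hq : q ∈ subgrad Ω w (centroid s + c • (x - centroid s)))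
    (hyΩ : c • x + (1 - c) • y ∈ Ω) (hy : w (c • x + (1 - c) • y) ≤ 0) :
    (1 - c) * ⟪q, y - centroid s⟫ ≤ H := by
  have h := hq _ hyΩ
  have h2 : c • x + (1 - c) • y - (centroid s + c • (x - centroid s))
      = (1 - c) • (y - centroid s) := by module
  rw [h2, inner_smul_right] at h
  linarith

open scoped Pointwise in
theorem iUnion_subgrad_subset_smul_polarAt {n : ℕ} {Ω s : Set (En n)} (hsΩ : s ⊆ Ω)
    (ho : IsOpen s) (hc : Convex ℝ s) (hb : Bornology.IsBounded s) {w : En n → ℝ} {c H : ℝ}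
    (hc0 : 0 < c) (hc1 : c < 1) (hH : 0 < H) (hw : ∀ x ∈ s, w x ≤ 0) (hw' : ∀ x ∈ s, -H ≤ w x) :
    (⋃ x ∈ (fun y => centroid s + c • (y - centroid s)) '' s, subgrad Ω w x) ⊆
      (H / (1 - c)) • polarAt s (centroid s) := by
  intro q hq
  obtain ⟨_, ⟨x, hx, rfl⟩, hq⟩ := mem_iUnion₂.1 hq
  have h1c : 0 < 1 - c := by linarith
  rw [mem_smul_set_iff_inv_smul_mem₀ (by positivity)]
  intro y hy
  have hmem : c • x + (1 - c) • y ∈ s := hc hx hy hc0.le h1c.le (by ring)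
  have := inner_le_of_mem_subgrad
    (hw' _ (smul_centroid_image_subset ho hc hb hc0 hc1 (mem_image_of_mem _ hx))) hq
    (hsΩ hmem) (hw _ hmem)
  rw [real_inner_smul_left, inv_div, div_mul_eq_mul_div, div_le_one hH]
  exact this

open scoped Pointwise in
theorem volume_smul_En {n : ℕ} {r : ℝ} (hr : 0 ≤ r) (s : Set (En n)) :
    volume (r • s) = ENNReal.ofReal (r ^ n) * volume s := by
  rw [Measure.addHaar_smul, abs_of_nonneg (by positivity)]
  simp

/-- An extreme point of a compact convex set `k` can be strictly separated from any compact subset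
of `k` not containing it. -/
theorem exists_separation_of_extreme {n : ℕ} {k t : Set (En n)} (hk : IsCompact k)
    (hkc : Convex ℝ k) (ht : IsCompact t) (htk : t ⊆ k) {x₀ : En n}
    (hx₀ : x₀ ∈ k.extremePoints ℝ) (hx₀t : x₀ ∉ t) :
    ∃ (e : En n) (s : ℝ), (∀ y ∈ t, ⟪e, y⟫ < s) ∧ s < ⟪e, x₀⟫ := by
  have key : ∃ H ⊆ k, IsCompact H ∧ Convex ℝ H ∧ t ⊆ H ∧ x₀ ∉ H := by
    refine ht.induction_on (p := fun t => ∃ H ⊆ k, IsCompact H ∧ Convex ℝ H ∧ t ∩ k ⊆ H ∧ x₀ ∉ H)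
      ?_ ?_ ?_ ?_ |>.imp fun H hH => by rwa [inter_eq_left.2 htk] at hH
    · exact ⟨∅, empty_subset _, isCompact_empty, convex_empty, by simp, by simp⟩
    · rintro a b hab ⟨H, h1, h2, h3, h4, h5⟩
      exact ⟨H, h1, h2, h3, (inter_subset_inter_left _ hab).trans h4, h5⟩
    · rintro a b ⟨H, h1, h2, h3, h4, h5⟩ ⟨H', h1', h2', h3', h4', h5'⟩
      rcases H.eq_empty_or_nonempty with rfl | hne
      · refine ⟨H', h1', h2', h3', ?_, h5'⟩
        rw [union_inter_distrib_right]
        exact union_subset (h4.trans (empty_subset _)) h4'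
      rcases H'.eq_empty_or_nonempty with rfl | hne'
      · refine ⟨H, h1, h2, h3, ?_, h5⟩
        rw [union_inter_distrib_right]
        exact union_subset h4 (h4'.trans (empty_subset _))
      refine ⟨convexJoin ℝ H H', ?_, ?_, h3.convexJoin h3', ?_, ?_⟩
      · exact convexJoin_subset h1 h1' hkc
      · have : convexJoin ℝ H H' =
            (fun p : ℝ × En n × En n => (1 - p.1) • p.2.1 + p.1 • p.2.2) ''
              (Icc (0 : ℝ) 1 ×ˢ H ×ˢ H') := by
          ext z
          simp only [mem_convexJoin, segment_eq_image, mem_image, Prod.exists, mem_prod]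
          grind
        rw [this]
        exact (isCompact_Icc.prod (h2.prod h2')).image (by fun_prop)
      · rw [union_inter_distrib_right]
        exact union_subset (h4.trans (subset_convexJoin_left hne'))
          (h4'.trans (subset_convexJoin_right hne))
      · intro hmem
        obtain ⟨p, hp, q, hq, hpq⟩ := mem_convexJoin.1 hmem
        have := (mem_extremePoints_iff_forall_segment.1 hx₀).2 p (h1 hp) q (h1' hq) hpq
        rcases this with rfl | rfl
        · exact h5 hp
        · exact h5' hq
    · intro x hx
      have hne : 0 < dist x₀ x := dist_pos.2 fun h => hx₀t (h ▸ hx)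
      refine ⟨Metric.closedBall x (dist x₀ x / 2), mem_nhdsWithin_of_mem_nhds
        (Metric.closedBall_mem_nhds _ (by positivity)), Metric.closedBall x (dist x₀ x / 2) ∩ k,
        inter_subset_right, hk.inter_left Metric.isClosed_closedBall,
        (convex_closedBall _ _).inter hkc, subset_rfl, fun h => ?_⟩
      have := Metric.mem_closedBall.1 h.1
      linarith
  obtain ⟨H, -, h2, h3, h4, h5⟩ := key
  obtain ⟨F, s, hF, hs⟩ := geometric_hahn_banach_closed_point h3 h2.isClosed h5
  refine ⟨(InnerProductSpace.toDual ℝ (En n)).symm F, s, fun y hy => ?_, ?_⟩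
  · rw [InnerProductSpace.toDual_symm_apply]; exact hF y (h4 hy)
  · rw [InnerProductSpace.toDual_symm_apply]; exact hs

/-- A section `{w < l}` whose closure stays away from the sphere lies in the ball. -/
theorem section_subset_ball {n : ℕ} {Ω : Set (En n)} {g : En n → ℝ} (hg : ConvexOn ℝ Ω g)
    {x₀ : En n} {R : ℝ} (hR : 0 < R) (hx₀ : x₀ ∈ Ω) (hgx₀ : g x₀ < 0)
    (hsph : ∀ y ∈ Metric.sphere x₀ R, y ∈ Ω → 0 ≤ g y) :
    {x ∈ Ω | g x < 0} ⊆ Metric.ball x₀ R := by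
  intro y hy
  by_contra hyR
  rw [Metric.mem_ball, dist_eq_norm, not_lt] at hyR
  have hpos : 0 < ‖y - x₀‖ := hR.trans_le hyR
  set t := R / ‖y - x₀‖ with ht
  have ht1 : t ≤ 1 := (div_le_one hpos).2 hyR
  have ht0 : 0 < t := div_pos hR hpos
  have hmem := (hg.convex_lt 0) hy ⟨hx₀, hgx₀⟩ ht0.le (by linarith : 0 ≤ 1 - t) (by ring)
  refine absurd hmem.2 (not_lt.2 (hsph _ ?_ hmem.1))
  rw [mem_sphere_iff_norm]
  have : t • y + (1 - t) • x₀ - x₀ = t • (y - x₀) := by module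
  rw [this, norm_smul, Real.norm_of_nonneg ht0.le, ht, div_mul_cancel₀ _ hpos.ne']

/-- If the zero set of a nonnegative convex function contains no segment around its point `x₀` but
is not reduced to `x₀`, an affine function positive at `x₀` cuts off a cap of the zero set that is
contained in a ball around `x₀`. -/
theorem exists_cap_of_no_segment {n : ℕ} {Ω : Set (En n)} (hΩ : IsOpen Ω) {w : En n → ℝ}
    (hw : ConvexOn ℝ Ω w) (hw0 : ∀ x ∈ Ω, 0 ≤ w x)
    {x₀ x₁ : En n} (hx₀ : x₀ ∈ Ω) (hx₁ : x₁ ∈ Ω) (hne : x₁ ≠ x₀) (hwx₀ : w x₀ = 0)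
    (hwx₁ : w x₁ = 0)
    (hcon : ¬ ∃ e ≠ 0, x₀ + e ∈ Ω ∧ x₀ - e ∈ Ω ∧ w (x₀ + e) = 0 ∧ w (x₀ - e) = 0) :
    ∃ R > 0, Metric.closedBall x₀ R ⊆ Ω ∧ IsCompact {y ∈ Metric.closedBall x₀ R | w y = 0} ∧
      ∃ (e : En n) (s : ℝ), s < ⟪e, x₀⟫ ∧
      (∀ y ∈ {y ∈ Metric.closedBall x₀ R | w y = 0} ∩ Metric.sphere x₀ R, ⟪e, y⟫ < s) ∧
      ∃ y ∈ {y ∈ Metric.closedBall x₀ R | w y = 0}, ⟪e, y⟫ - s = (⟪e, x₀⟫ - s) / 2 := by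
  have hcont : ContinuousOn w Ω := hw.continuousOn hΩ
  have hD : 0 < ‖x₁ - x₀‖ := norm_pos_iff.2 (sub_ne_zero.2 hne)
  obtain ⟨R, hR, hRΩ, hRD⟩ : ∃ R > 0, Metric.closedBall x₀ R ⊆ Ω ∧ R ≤ ‖x₁ - x₀‖ := by
    obtain ⟨r, hr, hrΩ⟩ := Metric.nhds_basis_closedBall.mem_iff.1 (hΩ.mem_nhds hx₀)
    exact ⟨min r ‖x₁ - x₀‖, lt_min hr hD,
      (Metric.closedBall_subset_closedBall (min_le_left _ _)).trans hrΩ, min_le_right _ _⟩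
  have hBcpt : IsCompact (Metric.closedBall x₀ R) := isCompact_closedBall x₀ R
  have hwB : ContinuousOn w (Metric.closedBall x₀ R) := hcont.mono hRΩ
  set k := {y ∈ Metric.closedBall x₀ R | w y = 0} with hk
  have hkcpt : IsCompact k := by
    refine hBcpt.of_isClosed_subset ?_ (sep_subset _ _)
    exact hwB.preimage_isClosed_of_isClosed Metric.isClosed_closedBall isClosed_singleton
  have hkconv : Convex ℝ k := by
    intro p hp q hq a b ha hb hab
    have hm := (convex_closedBall x₀ R) hp.1 hq.1 ha hb hab
    refine ⟨hm, le_antisymm ?_ (hw0 _ (hRΩ hm))⟩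
    have := hw.2 (hRΩ hp.1) (hRΩ hq.1) ha hb hab
    rw [hp.2, hq.2] at this
    simpa using this
  have hx₀k : x₀ ∈ k := ⟨Metric.mem_closedBall_self hR.le, hwx₀⟩
  have hext : x₀ ∈ k.extremePoints ℝ := by
    rw [mem_extremePoints]
    refine ⟨hx₀k, fun p hp q hq hpq => ?_⟩
    by_contra hne'
    have hpq' : p ≠ q := by
      rintro rfl
      rw [openSegment_same, mem_singleton_iff] at hpq
      exact hne' ⟨hpq.symm, hpq.symm⟩
    obtain ⟨a, b, ha, hb, hab, hx⟩ := hpq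
    set m := min a b with hm
    have hm0 : 0 < m := lt_min ha hb
    have h1 : x₀ + m • (p - q) ∈ k := by
      have := hkconv hp hq (by linarith : 0 ≤ a + m)
        (by linarith [min_le_right a b] : 0 ≤ b - m) (by linarith)
      convert this using 1
      rw [← hx]; module
    have h2 : x₀ - m • (p - q) ∈ k := by
      have := hkconv hp hq (by linarith [min_le_left a b] : 0 ≤ a - m)
        (by linarith : 0 ≤ b + m) (by linarith)
      convert this using 1
      rw [← hx]; module
    exact hcon ⟨m • (p - q), smul_ne_zero hm0.ne' (sub_ne_zero.2 hpq'), hRΩ h1.1, hRΩ h2.1,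
      h1.2, h2.2⟩
  obtain ⟨e, s, hesph, hex₀⟩ := exists_separation_of_extreme hkcpt hkconv
    (t := k ∩ Metric.sphere x₀ R) (hkcpt.inter_right Metric.isClosed_sphere) inter_subset_left hext
    (fun h => by have := h.2; rw [Metric.mem_sphere, dist_self] at this; linarith)
  set f : En n → ℝ := fun y => ⟪e, y⟫ - s with hf
  have hfx₀ : 0 < f x₀ := by simp only [hf]; linarith
  refine ⟨R, hR, hRΩ, hkcpt, e, s, hex₀, hesph, ?_⟩
  have hy₁ : x₀ + (R / ‖x₁ - x₀‖) • (x₁ - x₀) ∈ k ∩ Metric.sphere x₀ R := by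
    have hs : x₀ + (R / ‖x₁ - x₀‖) • (x₁ - x₀) ∈ Metric.sphere x₀ R := by
      rw [mem_sphere_iff_norm, add_sub_cancel_left, norm_smul,
        Real.norm_of_nonneg (by positivity), div_mul_cancel₀ _ hD.ne']
    refine ⟨⟨Metric.sphere_subset_closedBall hs, ?_⟩, hs⟩
    refine le_antisymm ?_ (hw0 _ (hRΩ (Metric.sphere_subset_closedBall hs)))
    set t := R / ‖x₁ - x₀‖ with ht
    have ht1 : t ≤ 1 := (div_le_one hD).2 hRD
    have := hw.2 hx₀ hx₁ (by linarith : 0 ≤ 1 - t) (by positivity : 0 ≤ t) (by ring)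
    rw [hwx₀, hwx₁] at this
    have h3 : x₀ + t • (x₁ - x₀) = (1 - t) • x₀ + t • x₁ := by module
    rw [h3]
    simpa using this
  have hneg := hesph _ hy₁
  set y₁ := x₀ + (R / ‖x₁ - x₀‖) • (x₁ - x₀)
  have hneg' : f y₁ < 0 := by simp only [hf]; linarith
  have hden : 0 < f x₀ - f y₁ := by linarith
  set t := (f x₀ / 2 - f y₁) / (f x₀ - f y₁) with ht
  have ht0 : 0 ≤ t := div_nonneg (by linarith) hden.le
  have ht1 : t ≤ 1 := (div_le_one hden).2 (by linarith)
  refine ⟨t • x₀ + (1 - t) • y₁, hkconv hx₀k hy₁.1 ht0 (by linarith) (by ring), ?_⟩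
  have h4 : t * (f x₀ - f y₁) = f x₀ / 2 - f y₁ := div_mul_cancel₀ _ hden.ne'
  have h5 : f (t • x₀ + (1 - t) • y₁) = t * f x₀ + (1 - t) * f y₁ := by
    simp only [hf, inner_add_right, inner_smul_right]; ring
  change f (t • x₀ + (1 - t) • y₁) = f x₀ / 2
  rw [h5]; linarith

open scoped Pointwise in
set_option maxHeartbeats 400000 in
/-- For a nonnegative convex function with doubling Monge–Ampère measure whose zero set is not a
single point, each point of the zero set is interior to a segment contained in the zero set. -/
theorem exists_segment_zero {n : ℕ} {Ω : Set (En n)} (hΩ : IsOpen Ω) {w : En n → ℝ}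
    (hw : ConvexOn ℝ Ω w) (hw0 : ∀ x ∈ Ω, 0 ≤ w x) (hd : Doubling (MAm Ω w) Ω)
    {x₀ x₁ : En n} (hx₀ : x₀ ∈ Ω) (hx₁ : x₁ ∈ Ω) (hne : x₁ ≠ x₀) (hwx₀ : w x₀ = 0)
    (hwx₁ : w x₁ = 0) :
    ∃ e ≠ 0, x₀ + e ∈ Ω ∧ x₀ - e ∈ Ω ∧ w (x₀ + e) = 0 ∧ w (x₀ - e) = 0 := by
  by_contra hcon
  obtain ⟨R, hR, hRΩ, hkcpt, e, s, hex₀, hesph, y₀, hy₀k, hy₀⟩ :=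
    exists_cap_of_no_segment hΩ hw hw0 hx₀ hx₁ hne hwx₀ hwx₁ hcon
  have hBcpt : IsCompact (Metric.closedBall x₀ R) := isCompact_closedBall x₀ R
  have hwB : ContinuousOn w (Metric.closedBall x₀ R) := (hw.continuousOn hΩ).mono hRΩ
  set k := {y ∈ Metric.closedBall x₀ R | w y = 0} with hk
  have hx₀k : x₀ ∈ k := ⟨Metric.mem_closedBall_self hR.le, hwx₀⟩
  set f : En n → ℝ := fun y => ⟪e, y⟫ - s with hf
  have hfcont : Continuous f := by fun_prop
  have hfx₀ : 0 < f x₀ := by simp only [hf]; linarith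
  replace hy₀ : f y₀ = f x₀ / 2 := hy₀
  obtain ⟨z, hzk, hzmax⟩ := hkcpt.exists_isMaxOn ⟨x₀, hx₀k⟩ hfcont.continuousOn
  have hzmax' : ∀ y ∈ k, f y ≤ f z := fun y hy => hzmax hy
  have hF : f x₀ ≤ f z := hzmax' _ hx₀k
  set F := f z with hFdef
  have hF0 : 0 < F := by linarith
  obtain ⟨c, b, ⟨hc0, hc1⟩, hb0, hdoub⟩ := hd
  have h1c : 0 < 1 - c := by linarith
  set K : ℝ := 2 ^ (n + 1) with hK
  have hK0 : 0 < K := by positivity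
  obtain ⟨N, hN⟩ := exists_nat_gt (max 1 (b⁻¹ * (8 * (K + 1) / (1 - c)) ^ n))
  have hN1 : (1 : ℝ) < N := (le_max_left _ _).trans_lt hN
  set η : ℝ := 1 / (8 * N) with hη
  have hN0 : (0 : ℝ) < N := by linarith
  have hη0 : 0 < η := by positivity
  have hη1 : η ≤ 1 := by rw [hη, div_le_one (by positivity)]; linarith
  -- the bad set on which `w` is bounded below
  set Q := (Metric.closedBall x₀ R ∩ {y | F * (1 + η) ≤ f y}) ∪
    (Metric.sphere x₀ R ∩ {y | 0 ≤ f y}) with hQ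
  have hQcpt : IsCompact Q :=
    (hBcpt.inter_right (isClosed_le continuous_const hfcont)).union
      ((isCompact_sphere x₀ R).inter_right (isClosed_le continuous_const hfcont))
  have hQB : Q ⊆ Metric.closedBall x₀ R :=
    union_subset inter_subset_left (inter_subset_left.trans Metric.sphere_subset_closedBall)
  have hQpos : ∀ y ∈ Q, 0 < w y := by
    intro y hy
    refine lt_of_le_of_ne (hw0 _ (hRΩ (hQB hy))) fun h0 => ?_
    have hyk : y ∈ k := ⟨hQB hy, h0.symm⟩
    rcases hy with hy | hy
    · have h1 := hzmax' _ hyk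
      have h2 : F * (1 + η) ≤ f y := hy.2
      nlinarith
    · have h1 := hesph y ⟨hyk, hy.1⟩
      have h2 : 0 ≤ f y := hy.2
      simp only [hf] at h2
      linarith
  obtain ⟨m, hm0, hm⟩ : ∃ m > 0, ∀ y ∈ Q, m ≤ w y := by
    rcases Q.eq_empty_or_nonempty with h | h
    · exact ⟨1, one_pos, by simp [h]⟩
    · obtain ⟨y, hy, hmin⟩ := hQcpt.exists_isMinOn h (hwB.mono hQB)
      exact ⟨w y, hQpos y hy, fun y' hy' => hmin hy'⟩
  obtain ⟨M, hM⟩ := (hBcpt.image hfcont).bddAbove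
  have hM' : ∀ y ∈ Metric.closedBall x₀ R, f y ≤ M := fun y hy => hM (mem_image_of_mem _ hy)
  have hM0 : 0 < M := hfx₀.trans_le (hM' _ hx₀k.1)
  set ε := m / M with hε
  have hε0 : 0 < ε := by positivity
  have hεM : ε * M = m := div_mul_cancel₀ _ hM0.ne'
  set g : En n → ℝ := fun y => w y - (⟪ε • e, y⟫ + -(ε * s)) with hg
  have hgf : ∀ y, g y = w y - ε * f y := by
    intro y; simp only [hg, hf, real_inner_smul_left]; ring
  have hgconv : ConvexOn ℝ Ω g := hw.sub_affine _ _
  have hgM : MAm Ω g = MAm Ω w := MAm_sub_affine Ω w _ _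
  have hgQ : ∀ y ∈ Q, 0 ≤ g y := by
    intro y hy
    have h1 := hm y hy
    have h2 := hM' y (hQB hy)
    rw [hgf]
    nlinarith
  set S := {x ∈ Ω | g x < 0} with hS
  have hzΩ : z ∈ Ω := hRΩ hzk.1
  have hgk : ∀ y ∈ k, g y = -(ε * f y) := fun y hy => by rw [hgf, hy.2]; ring
  have hkS : ∀ y ∈ k, 0 < f y → y ∈ S := fun y hy hfy =>
    ⟨hRΩ hy.1, by rw [hgk y hy]; have := mul_pos hε0 hfy; linarith⟩
  have hx₀S : x₀ ∈ S := hkS x₀ hx₀k hfx₀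
  have hSf : ∀ y ∈ S, 0 < f y := by
    intro y hy
    have h1 := hw0 y hy.1
    have h2 := hy.2
    rw [hgf] at h2
    by_contra hcon'
    push Not at hcon'
    nlinarith
  have hSball : S ⊆ Metric.ball x₀ R := by
    refine section_subset_ball hgconv hR hx₀ hx₀S.2 fun y hy hyΩ => ?_
    by_cases hfy : 0 ≤ f y
    · exact hgQ y (Or.inr ⟨hy, hfy⟩)
    · rw [hgf]
      have := hw0 y hyΩ
      nlinarith
  have hSB : S ⊆ Metric.closedBall x₀ R := hSball.trans Metric.ball_subset_closedBall
  have hSF : ∀ y ∈ S, f y ≤ F * (1 + η) := by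
    intro y hy
    by_contra hcon'
    push Not at hcon'
    exact absurd hy.2 (not_lt.2 (hgQ y (Or.inl ⟨hSB hy, hcon'.le⟩)))
  have hSo : IsOpen S := isOpen_section hΩ hgconv
  have hSc : Convex ℝ S := hgconv.convex_lt 0
  have hSb : Bornology.IsBounded S := Metric.isBounded_closedBall.subset hSB
  have hScl : closure S ⊆ Ω := (closure_minimal hSB Metric.isClosed_closedBall).trans hRΩ
  set h := ε * F with hh
  have hh0 : 0 < h := by positivity
  have hzS : z ∈ S := hkS z hzk hF0
  have hy₀S : y₀ ∈ S := hkS y₀ hy₀k (by linarith)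
  set A := polarAt S (centroid S) with hA
  set lam := h / (4 * (K + 1)) with hlam
  have hlam0 : 0 < lam := by positivity
  have hlamK : lam * (K + 1) = h / 4 := by rw [hlam]; field_simp
  have hlow : N * volume (lam • A) ≤ MAm Ω g S := by
    refine le_trans ?_ (measure_mono (subset_iUnion_subgrad hΩ hgconv hScl hSb hh0 hzΩ
      (by rw [hgk z hzk])))
    refine nat_mul_volume_le (((isClosed_polarAt _ _).smul₀ lam).measurableSet)
      (d := z - y₀) (e := (2 * h / F) • e) (s := h / 2 - h / 8) ?_ ?_ N ?_
    · rintro _ ⟨q, hq, rfl⟩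
      have h1 := abs_inner_centroid_le hSo hSc hSb hq hzS
      have h2 := hq _ hzS
      have h3 := abs_inner_centroid_le hSo hSc hSb hq hy₀S
      have h4 := hq _ hy₀S
      have h5 : ⟪z - y₀, lam • q⟫ = lam * (⟪q, z - centroid S⟫ - ⟪q, y₀ - centroid S⟫) := by
        rw [real_inner_comm, real_inner_smul_left, ← inner_sub_right, sub_sub_sub_cancel_right]
      simp only at h5 ⊢
      rw [h5, abs_mul, abs_of_pos hlam0]
      have h6 : |⟪q, z - centroid S⟫ - ⟪q, y₀ - centroid S⟫| ≤ K + 1 := by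
        rw [abs_le] at h1 h3 ⊢
        constructor <;> linarith
      nlinarith
    · have h1 : ⟪z - y₀, e⟫ = F - f x₀ / 2 := by
        rw [← hy₀, hFdef, real_inner_comm, inner_sub_right]; simp only [hf]; ring
      rw [inner_smul_right, h1]
      have h2 : 2 * h / F * (F / 2) = h := by field_simp
      have h3 : 0 < 2 * h / F := by positivity
      nlinarith
    · rintro i hi _ ⟨q, hq, rfl⟩ y hy
      have h1 := hq _ hy
      have h2 := (abs_le.1 (abs_inner_centroid_le hSo hSc hSb hq hzS)).1
      have h3 : ⟪q, y - z⟫ = ⟪q, y - centroid S⟫ - ⟪q, z - centroid S⟫ := by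
        rw [← inner_sub_right, sub_sub_sub_cancel_right]
      have h4 : ⟪e, y - z⟫ = f y - F := by
        rw [hFdef, inner_sub_right]; simp only [hf]; ring
      have h5 := hSF y hy
      simp only
      rw [inner_add_left, real_inner_smul_left, real_inner_smul_left, real_inner_smul_left, h3, h4]
      have h6 : (i : ℝ) ≤ N := by exact_mod_cast hi.le
      have h7 : (i : ℝ) * (2 * h / F * (f y - F)) ≤ h / 4 := by
        have h8 : 2 * h / F * (f y - F) ≤ 2 * h * η := by
          rw [div_mul_eq_mul_div, div_le_iff₀ hF0]
          nlinarith
        calc (i : ℝ) * (2 * h / F * (f y - F)) ≤ i * (2 * h * η) := by gcongr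
          _ ≤ N * (2 * h * η) := by gcongr
          _ = h / 4 := by rw [hη]; field_simp; ring
      have h9 : lam * (⟪q, y - centroid S⟫ - ⟪q, z - centroid S⟫) ≤ lam * (K + 1) := by
        gcongr; linarith
      linarith
  have hup : MAm Ω g ((fun y => centroid S + c • (y - centroid S)) '' S)
      ≤ volume ((2 * h / (1 - c)) • A) := by
    refine measure_mono (iUnion_subgrad_subset_smul_polarAt (sep_subset _ _) hSo hSc hSb hc0 hc1
      (by positivity) (fun x hx => hx.2.le) fun x hx => ?_)
    rw [hgf]
    have h1 := hw0 x hx.1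
    have h2 := hSF x hx
    have h3 : f x ≤ 2 * F := by nlinarith
    nlinarith
  have hdS := hdoub S (sep_subset _ _) hSc hSb ⟨x₀, by rwa [hSo.interior_eq]⟩
  rw [← hgM] at hdS
  have hApos : volume A ≠ 0 := (volume_polarAt_pos hSb _).ne'
  have hAtop : volume A ≠ ∞ := (volume_polarAt_lt_top hSo hSc hSb ⟨x₀, hx₀S⟩).ne
  have hfin : ENNReal.ofReal b * (N * (ENNReal.ofReal (lam ^ n) * volume A))
      ≤ ENNReal.ofReal ((2 * h / (1 - c)) ^ n) * volume A := by
    rw [← volume_smul_En hlam0.le, ← volume_smul_En (by positivity)]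
    exact (mul_le_mul_right hlow _).trans (hdS.trans hup)
  rw [← mul_assoc, ← mul_assoc, ENNReal.mul_le_mul_iff_left hApos hAtop,
    ← ENNReal.ofReal_natCast, ← ENNReal.ofReal_mul hb0.le, ← ENNReal.ofReal_mul (by positivity),
    ENNReal.ofReal_le_ofReal_iff (by positivity)] at hfin
  have h1 : 2 * h / (1 - c) = 8 * (K + 1) / (1 - c) * lam := by rw [hlam]; field_simp; ring
  rw [h1, mul_pow] at hfin
  have h2 := le_of_mul_le_mul_right hfin (by positivity)
  have h3 := (le_max_right _ _).trans_lt hN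
  rw [inv_mul_lt_iff₀ hb0] at h3
  linarith

open scoped Pointwise in
/-- If `0 ≤ v ≤ u`, the Monge–Ampère measure of `u` is doubling and controlled by that of `v`, and
`v` vanishes on a segment through a zero `x₀` of `u`, then `x₀` is not the only zero of `u`. -/
theorem exists_ne_zero_of_segment_zero {n : ℕ} {Ω : Set (En n)} (hΩ : IsOpen Ω) {u v : En n → ℝ}
    (hu : ConvexOn ℝ Ω u) (hv : ConvexOn ℝ Ω v) (hv0 : ∀ x ∈ Ω, 0 ≤ v x)
    (hvu : ∀ x ∈ Ω, v x ≤ u x) {C : ℝ} (hC : 0 ≤ C)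
    (hMuv : ∀ s : Set (En n), s ⊆ Ω → MeasurableSet s →
      MAm Ω u s ≤ ENNReal.ofReal C * MAm Ω v s)
    (hd : Doubling (MAm Ω u) Ω) {x₀ e : En n} (hx₀ : x₀ ∈ Ω) (hux₀ : u x₀ = 0) (he : e ≠ 0)
    (hp : x₀ + e ∈ Ω) (hm : x₀ - e ∈ Ω) (hvp : v (x₀ + e) = 0) (hvm : v (x₀ - e) = 0) :
    ∃ x ∈ Ω, x ≠ x₀ ∧ u x = 0 := by
  by_contra hcon
  have hupos : ∀ x ∈ Ω, x ≠ x₀ → 0 < u x := fun x hx hne =>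
    lt_of_le_of_ne ((hv0 x hx).trans (hvu x hx)) fun h => hcon ⟨x, hx, hne, h.symm⟩
  have hE : 0 < ‖e‖ := norm_pos_iff.2 he
  obtain ⟨c, b, ⟨hc0, hc1⟩, hb0, hdoub⟩ := hd
  have h1c : 0 < 1 - c := by linarith
  set K : ℝ := 2 ^ (n + 1) with hK
  have hK0 : 0 < K := by positivity
  obtain ⟨N, hN⟩ := exists_nat_gt (max 1 (b⁻¹ * (C * (4 * (K + 1) / (1 - c)) ^ n)))
  have hN1 : (1 : ℝ) < N := (le_max_left _ _).trans_lt hN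
  have hN0 : (0 : ℝ) < N := by linarith
  obtain ⟨R, hR, hRΩ, hRe⟩ : ∃ R > 0, Metric.closedBall x₀ R ⊆ Ω ∧
      R ≤ ‖e‖ / (4 * N * (K + 2)) := by
    obtain ⟨r, hr, hrΩ⟩ := Metric.nhds_basis_closedBall.mem_iff.1 (hΩ.mem_nhds hx₀)
    exact ⟨min r _, lt_min hr (by positivity),
      (Metric.closedBall_subset_closedBall (min_le_left _ _)).trans hrΩ, min_le_right _ _⟩
  have hsphΩ : Metric.sphere x₀ R ⊆ Ω := Metric.sphere_subset_closedBall.trans hRΩ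
  obtain ⟨h, hh0, hh⟩ : ∃ h > 0, ∀ y ∈ Metric.sphere x₀ R, h ≤ u y := by
    rcases (Metric.sphere x₀ R).eq_empty_or_nonempty with h | h
    · exact ⟨1, one_pos, by simp [h]⟩
    · obtain ⟨y, hy, hmin⟩ := (isCompact_sphere x₀ R).exists_isMinOn h
        ((hu.continuousOn hΩ).mono hsphΩ)
      refine ⟨u y, hupos y (hsphΩ hy) ?_, fun y' hy' => hmin hy'⟩
      rintro rfl
      rw [Metric.mem_sphere, dist_self] at hy
      linarith
  set g : En n → ℝ := fun y => u y - (⟪0, y⟫ + h) with hg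
  set w : En n → ℝ := fun y => v y - (⟪0, y⟫ + h) with hw
  have hgu : ∀ y, g y = u y - h := fun y => by simp only [hg, inner_zero_left, zero_add]
  have hwv : ∀ y, w y = v y - h := fun y => by simp only [hw, inner_zero_left, zero_add]
  have hgconv : ConvexOn ℝ Ω g := hu.sub_affine _ _
  have hgM : MAm Ω g = MAm Ω u := MAm_sub_affine Ω u _ _
  have hwM : MAm Ω w = MAm Ω v := MAm_sub_affine Ω v _ _
  have hwconv : ConvexOn ℝ Ω w := hv.sub_affine _ _
  set S := {x ∈ Ω | g x < 0} with hS
  have hx₀S : x₀ ∈ S := ⟨hx₀, by rw [hgu, hux₀]; linarith⟩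
  have hSball : S ⊆ Metric.ball x₀ R :=
    section_subset_ball hgconv hR hx₀ hx₀S.2 fun y hy _ => by rw [hgu]; linarith [hh y hy]
  have hSB : S ⊆ Metric.closedBall x₀ R := hSball.trans Metric.ball_subset_closedBall
  have hSo : IsOpen S := isOpen_section hΩ hgconv
  have hSc : Convex ℝ S := hgconv.convex_lt 0
  have hSb : Bornology.IsBounded S := Metric.isBounded_closedBall.subset hSB
  have hScB : closure S ⊆ Metric.closedBall x₀ R :=
    closure_minimal hSB Metric.isClosed_closedBall
  have hScl : closure S ⊆ Ω := hScB.trans hRΩ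
  have hcen : centroid S ∈ Metric.closedBall x₀ R :=
    hScB (centroid_mem_closure hSo hSc hSb ⟨x₀, hx₀S⟩)
  set A := polarAt S (centroid S) with hA
  set lam := h / (2 * (K + 1)) with hlam
  have hlam0 : 0 < lam := by positivity
  have hlamK : lam * (K + 1) = h / 2 := by rw [hlam]; field_simp
  have hlow : volume (lam • A) ≤ MAm Ω g S := by
    refine measure_mono (Subset.trans ?_ (subset_iUnion_subgrad hΩ hgconv hScl hSb hh0 hx₀
      (by rw [hgu, hux₀, zero_sub])))
    rintro _ ⟨q, hq, rfl⟩ y hy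
    have h1 := hq _ hy
    have h2 := (abs_le.1 (abs_inner_centroid_le hSo hSc hSb hq hx₀S)).1
    have h3 : ⟪q, y - x₀⟫ = ⟪q, y - centroid S⟫ - ⟪q, x₀ - centroid S⟫ := by
      rw [← inner_sub_right, sub_sub_sub_cancel_right]
    simp only
    rw [real_inner_smul_left, h3, ← hlamK]
    gcongr
    linarith
  set D := A ∩ {q | |⟪e, q⟫| ≤ K + 1} with hD
  have hDcl : IsClosed D :=
    (isClosed_polarAt _ _).inter (isClosed_le (by fun_prop) continuous_const)
  have hup : MAm Ω w ((fun y => centroid S + c • (y - centroid S)) '' S)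
      ≤ volume ((h / (1 - c)) • D) := by
    have hw0 : ∀ x ∈ S, w x ≤ 0 := fun x hx => by
      have h1 := hx.2
      have h2 := hvu x hx.1
      rw [hgu] at h1
      rw [hwv]; linarith
    have hw1 : ∀ x ∈ Ω, -h ≤ w x := fun x hx => by rw [hwv]; linarith [hv0 x hx]
    refine measure_mono fun q hq => ?_
    have hqA := iUnion_subgrad_subset_smul_polarAt (sep_subset _ _) hSo hSc hSb hc0 hc1
      hh0 hw0 (fun x hx => hw1 x hx.1) hq
    obtain ⟨q, hqA, rfl⟩ := hqA
    refine smul_mem_smul_set ⟨hqA, ?_⟩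
    obtain ⟨_, ⟨x, hx, rfl⟩, hq⟩ := mem_iUnion₂.1 hq
    have hxΩ := (smul_centroid_image_subset hSo hSc hSb hc0 hc1 (mem_image_of_mem _ hx)).1
    have hend : ∀ y ∈ Ω, v y = 0 → ⟪q, y - centroid S⟫ ≤ 1 := by
      intro y hy hvy
      have hmem : c • x + (1 - c) • y ∈ Ω := hu.1 hx.1 hy hc0.le h1c.le (by ring)
      have hval : w (c • x + (1 - c) • y) ≤ 0 := by
        have h1 := hwconv.2 hx.1 hy hc0.le h1c.le (by ring)
        have h2 := hw0 x hx
        have h3 : w y = -h := by rw [hwv, hvy, zero_sub]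
        rw [h3] at h1
        simp only [smul_eq_mul] at h1
        nlinarith
      have h4 := inner_le_of_mem_subgrad (hw1 _ hxΩ) hq hmem hval
      simp only [real_inner_smul_left] at h4
      have h5 : (1 - c) * (h / (1 - c) * ⟪q, y - centroid S⟫) = h * ⟪q, y - centroid S⟫ := by
        field_simp
      rw [h5] at h4
      exact le_of_mul_le_mul_left (by linarith) hh0
    have h1 := hend _ hp hvp
    have h2 := hend _ hm hvm
    have h3 := (abs_le.1 (abs_inner_centroid_le hSo hSc hSb hqA hx₀S)).1
    rw [add_sub_right_comm, inner_add_right] at h1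
    rw [sub_right_comm, inner_sub_right] at h2
    rw [mem_ofPred_eq, real_inner_comm, abs_le]
    constructor <;> linarith
  have hpack : N * volume ((1 / 2 : ℝ) • D) ≤ volume A := by
    set τ := (K + 2) / ‖e‖ ^ 2 with hτ
    have hτ0 : 0 < τ := by positivity
    refine nat_mul_volume_le (hDcl.smul₀ (1 / 2 : ℝ)).measurableSet (d := e) (e := τ • e)
      (s := (K + 1) / 2) ?_ ?_ N ?_
    · rintro _ ⟨q, hq, rfl⟩
      have : |⟪e, q⟫| ≤ K + 1 := hq.2
      simp only [inner_smul_right, abs_mul]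
      rw [abs_of_pos (by norm_num : (0 : ℝ) < 1 / 2)]
      linarith
    · rw [inner_smul_right, real_inner_self_eq_norm_sq, hτ, div_mul_cancel₀ _ (by positivity)]
      linarith
    · rintro i hi _ ⟨q, hq, rfl⟩
      have hball : (2 * (i : ℝ) * τ) • e ∈ A := by
        refine closedBall_subset_polarAt (r := 2 * R) (by positivity) (fun y hy => ?_) ?_
        · rw [← dist_eq_norm]
          have h1 := Metric.mem_closedBall.1 (hSB hy)
          have h2 := Metric.mem_closedBall'.1 hcen
          linarith [dist_triangle y x₀ (centroid S)]
        · have h6 : (i : ℝ) ≤ N := by exact_mod_cast hi.le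
          rw [mem_closedBall_zero_iff, norm_smul, Real.norm_of_nonneg (by positivity),
            ← one_div, le_div_iff₀ (by positivity)]
          calc 2 * (i : ℝ) * τ * ‖e‖ * (2 * R)
              ≤ 2 * N * τ * ‖e‖ * (2 * (‖e‖ / (4 * N * (K + 2)))) := by gcongr
            _ = 1 := by rw [hτ]; field_simp; ring
      have := convex_polarAt S (centroid S) hq.1 hball (by norm_num : (0 : ℝ) ≤ 1 / 2)
        (by norm_num : (0 : ℝ) ≤ 1 / 2) (by norm_num)
      convert this using 1
      module
  have hdS := hdoub S (sep_subset _ _) hSc hSb ⟨x₀, by rwa [hSo.interior_eq]⟩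
  have himg := smul_centroid_image_subset hSo hSc hSb hc0 hc1
  have hMS := hMuv _ (himg.trans (sep_subset _ _)) (measurableSet_centroid_image hSo hc0)
  rw [← hwM] at hMS
  rw [← hgM] at hdS hMS
  have hApos : volume A ≠ 0 := (volume_polarAt_pos hSb _).ne'
  have hAtop : volume A ≠ ∞ := (volume_polarAt_lt_top hSo hSc hSb ⟨x₀, hx₀S⟩).ne
  have hDscale : (h / (1 - c)) • D = (2 * h / (1 - c)) • ((1 / 2 : ℝ) • D) := by
    rw [smul_smul]; congr 1; ring
  have hfin : N * (ENNReal.ofReal b * (ENNReal.ofReal (lam ^ n) * volume A))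
      ≤ ENNReal.ofReal C * (ENNReal.ofReal ((2 * h / (1 - c)) ^ n) * volume A) := by
    have h1 : ENNReal.ofReal b * (ENNReal.ofReal (lam ^ n) * volume A) ≤
        ENNReal.ofReal C * (ENNReal.ofReal ((2 * h / (1 - c)) ^ n) *
          volume ((1 / 2 : ℝ) • D)) := by
      rw [← volume_smul_En hlam0.le, ← volume_smul_En (by positivity), ← hDscale]
      exact (mul_le_mul_right hlow _).trans (hdS.trans (hMS.trans (mul_le_mul_right hup _)))
    calc _ ≤ N * (ENNReal.ofReal C * (ENNReal.ofReal ((2 * h / (1 - c)) ^ n) *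
          volume ((1 / 2 : ℝ) • D))) := mul_le_mul_right h1 _
      _ = ENNReal.ofReal C * (ENNReal.ofReal ((2 * h / (1 - c)) ^ n) *
          (N * volume ((1 / 2 : ℝ) • D))) := by ring
      _ ≤ _ := mul_le_mul_right (mul_le_mul_right hpack _) _
  rw [← mul_assoc, ← mul_assoc, ← mul_assoc, ENNReal.mul_le_mul_iff_left hApos hAtop,
    ← ENNReal.ofReal_natCast, ← ENNReal.ofReal_mul (by positivity),
    ← ENNReal.ofReal_mul (by positivity), ← ENNReal.ofReal_mul hC,
    ENNReal.ofReal_le_ofReal_iff (by positivity)] at hfin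
  have h1 : 2 * h / (1 - c) = 4 * (K + 1) / (1 - c) * lam := by rw [hlam]; field_simp; ring
  rw [h1, mul_pow, ← mul_assoc] at hfin
  have h2 := le_of_mul_le_mul_right hfin (by positivity)
  have h3 := (le_max_right _ _).trans_lt hN
  rw [inv_mul_lt_iff₀ hb0] at h3
  linarith

/-- At a non-strictly convex point, some supporting affine function of `u` touches `u` at a
second point. -/
theorem exists_subgrad_of_mem_SigmaSet {n : ℕ} {Ω : Set (En n)} (hΩ : IsOpen Ω) {u : En n → ℝ}
    (hu : ConvexOn ℝ Ω u) {x₀ : En n} (hx₀ : x₀ ∈ SigmaSet Ω u) :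
    ∃ p ∈ subgrad Ω u x₀, ∃ x ∈ Ω, x ≠ x₀ ∧ u x = u x₀ + ⟪p, x - x₀⟫ := by
  obtain ⟨hx₀Ω, hns⟩ := hx₀
  simp only [IsStrictConvexPt, not_forall, not_lt] at hns
  obtain ⟨x, hx, hne, hle⟩ := hns
  have hmid : (1 / 2 : ℝ) • (x + x₀) ∈ Ω := by
    have := hu.1 hx hx₀Ω (by norm_num : (0 : ℝ) ≤ 1 / 2) (by norm_num : (0 : ℝ) ≤ 1 / 2)
      (by norm_num)
    rwa [← smul_add] at this
  obtain ⟨p, hp⟩ := exists_mem_subgrad hΩ hu hmid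
  have h1 := hp x hx
  have h2 := hp x₀ hx₀Ω
  simp only [inner_sub_right, inner_smul_right, inner_add_right] at h1 h2
  refine ⟨p, fun y hy => ?_, x, hx, hne, ?_⟩
  · have h3 := hp y hy
    simp only [inner_sub_right, inner_smul_right, inner_add_right] at h3 ⊢
    linarith
  · rw [inner_sub_right]; linarith

/-- For doubling Monge–Ampère measure, `u` is affine on a segment around each of its non-strictly
convex points. -/
theorem exists_segment_of_mem_SigmaSet {n : ℕ} {Ω : Set (En n)} (hΩ : IsOpen Ω) {u : En n → ℝ}
    (hu : ConvexOn ℝ Ω u) (hd : Doubling (MAm Ω u) Ω) {x₀ : En n} (hx₀ : x₀ ∈ SigmaSet Ω u) :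
    ∃ p ∈ subgrad Ω u x₀, ∃ e ≠ 0, x₀ + e ∈ Ω ∧ x₀ - e ∈ Ω ∧ u (x₀ + e) = u x₀ + ⟪p, e⟫ ∧
      u (x₀ - e) = u x₀ - ⟪p, e⟫ := by
  obtain ⟨p, hp, x, hx, hne, hux⟩ := exists_subgrad_of_mem_SigmaSet hΩ hu hx₀
  rw [inner_sub_right] at hux
  obtain ⟨e, he, h1, h2, h3, h4⟩ := exists_segment_zero hΩ (hu.sub_affine p (u x₀ - ⟪p, x₀⟫))
    (fun y hy => by have := hp y hy; rw [inner_sub_right] at this; linarith)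
    (by rwa [MAm_sub_affine]) hx₀.1 hx hne (by ring) (by linarith)
  rw [inner_add_right] at h3
  rw [inner_sub_right] at h4
  exact ⟨p, hp, e, he, h1, h2, by linarith, by linarith⟩

theorem mem_SigmaSet_of_eq {n : ℕ} {Ω : Set (En n)} {u : En n → ℝ} {x₀ x p : En n}
    (hu : Convex ℝ Ω) (hp : p ∈ subgrad Ω u x₀) (hx₀ : x₀ ∈ Ω) (hx : x ∈ Ω) (hne : x ≠ x₀)
    (h : u x = u x₀ + ⟪p, x - x₀⟫) : x₀ ∈ SigmaSet Ω u := by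
  refine ⟨hx₀, fun hs => ?_⟩
  have hmid : (1 / 2 : ℝ) • (x + x₀) ∈ Ω := by
    have := hu hx hx₀ (by norm_num : (0 : ℝ) ≤ 1 / 2) (by norm_num : (0 : ℝ) ≤ 1 / 2)
      (by norm_num)
    rwa [← smul_add] at this
  have h1 := hs x hx hne
  have h2 := hp _ hmid
  simp only [inner_sub_right, inner_smul_right, inner_add_right] at h h2
  linarith

/-- Lemma 3.2 (Lemma `lem:measure constrain double equiv`): on the coincidence set
`Ω₀ = {u = v}`, the non-strictly convex points of `u` and of `v` coincide, provided
`Mu ≤ C·Mv` and both Monge–Ampère measures are doubling. -/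
theorem statement_12 {n : ℕ} (Ω : Set (En n)) (hΩo : IsOpen Ω)
    (u v : En n → ℝ) (hu : ConvexOn ℝ Ω u) (hv : ConvexOn ℝ Ω v)
    (huv : ∀ x ∈ Ω, v x ≤ u x)
    (C : ℝ) (hC : 1 ≤ C)
    (hMuv : ∀ s : Set (En n), s ⊆ Ω → MeasurableSet s →
      MAm Ω u s ≤ ENNReal.ofReal C * MAm Ω v s)
    (hdu : Doubling (MAm Ω u) Ω) (hdv : Doubling (MAm Ω v) Ω) :
    SigmaSet Ω u ∩ {x ∈ Ω | u x = v x} = SigmaSet Ω v ∩ {x ∈ Ω | u x = v x} := by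
  have hC0 : 0 ≤ C := by linarith
  ext x₀
  constructor
  · rintro ⟨hS, hx₀, heq⟩
    refine ⟨?_, hx₀, heq⟩
    obtain ⟨p, hp, e, he, h1, h2, h3, h4⟩ := exists_segment_of_mem_SigmaSet hΩo hu hdu hS
    obtain ⟨q, hq⟩ := exists_mem_subgrad hΩo hv hx₀
    have h5 := hq _ h1
    have h6 := hq _ h2
    rw [add_sub_cancel_left] at h5
    rw [sub_sub_cancel_left, inner_neg_right] at h6
    have h7 := huv _ h1
    have h8 := huv _ h2
    refine mem_SigmaSet_of_eq hv.1 hq hx₀ h1 (by simpa using he) ?_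
    rw [add_sub_cancel_left]
    linarith
  · rintro ⟨hS, hx₀, heq⟩
    refine ⟨?_, hx₀, heq⟩
    obtain ⟨p, hp, e, he, h1, h2, h3, h4⟩ := exists_segment_of_mem_SigmaSet hΩo hv hdv hS
    have hpu : p ∈ subgrad Ω u x₀ := fun y hy => by
      rw [heq]; exact (hp y hy).trans (huv y hy)
    obtain ⟨x, hx, hne, hux⟩ := exists_ne_zero_of_segment_zero hΩo
      (hu.sub_affine p (u x₀ - ⟪p, x₀⟫)) (hv.sub_affine p (u x₀ - ⟪p, x₀⟫))
      (fun y hy => by have := hp y hy; rw [inner_sub_right] at this; linarith)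
      (fun y hy => by linarith [huv y hy]) hC0
      (by simpa only [MAm_sub_affine] using hMuv) (by rwa [MAm_sub_affine]) hx₀ (by ring) he h1 h2
      (by rw [inner_add_right]; linarith) (by rw [inner_sub_right]; linarith)
    refine mem_SigmaSet_of_eq hu.1 hpu hx₀ hx hne ?_
    rw [inner_sub_right]
    linarith
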